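/- Let h, β ∈ ℝ with q the replica-symmetric fixed point q = E[tanh²(h+β√q Z)], and define φ̄(t) = ψ(t,q,q) = E[tanh(h+βZ')tanh(h+βZ'')] with Var(Z')=Var(Z'')=q, Cov(Z',Z'')=t. Then for every t ∈ [−q, 0): φ̄(t) ≥ χ(q)² + t, where χ(q) = E[tanh(h+β√q Z)]. In particular, if h ≠ 0, φ̄ has no fixed points in [−q, 0]. -/

import Mathlib

open MeasureTheory ProbabilityTheory

/-- `φ(x) = E[tanh²(h + β √x Z)]`, `Z` a standard Gaussian. -/
noncomputable def phi (h β x : ℝ) : ℝ :=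
  ∫ z, Real.tanh (h + β * Real.sqrt x * z) ^ 2 ∂(gaussianReal 0 1)

/-- `ψ(t,t',t'') = E[tanh(h + β Z') tanh(h + β Z'')]` with `(Z',Z'')` centered Gaussian,
`Var Z' = t'`, `Var Z'' = t''`, `Cov(Z',Z'') = t`. -/
noncomputable def psi (h β t t' t'' : ℝ) : ℝ :=
  ∫ z₁, ∫ z₂,
    Real.tanh (h + β * (Real.sqrt t' * z₁)) *
      Real.tanh (h + β * (t / Real.sqrt t' * z₁ + Real.sqrt (t'' - t ^ 2 / t') * z₂))
    ∂(gaussianReal 0 1) ∂(gaussianReal 0 1)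

/-- `χ(t) = E[tanh(h + β √t Z)]`, `Z` a standard Gaussian. -/
noncomputable def chi (h β t : ℝ) : ℝ :=
  ∫ z, Real.tanh (h + β * Real.sqrt t * z) ∂(gaussianReal 0 1)

noncomputable abbrev gam : Measure ℝ := gaussianReal 0 1

noncomputable abbrev gam3 : Measure (ℝ × ℝ × ℝ) := gam.prod (gam.prod gam)

lemma gam_char (a : ℝ) :
    ∫ z, Complex.exp ((a * z : ℝ) * Complex.I) ∂gam = Complex.exp (-(a ^ 2) / 2 : ℝ) := by
  have := charFun_gaussianReal (μ := 0) (v := 1) a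
  rw [charFun_apply_real] at this
  push_cast at this ⊢
  rw [this]
  congr 1
  simp
  ring

lemma gam3_char (a b c : ℝ) :
    ∫ p, Complex.exp ((a * p.1 + b * p.2.1 + c * p.2.2 : ℝ) * Complex.I) ∂gam3
      = Complex.exp (-(a ^ 2 + b ^ 2 + c ^ 2) / 2 : ℝ) := by
  have e : ∀ p : ℝ × ℝ × ℝ, Complex.exp ((a * p.1 + b * p.2.1 + c * p.2.2 : ℝ) * Complex.I)
      = Complex.exp ((a * p.1 : ℝ) * Complex.I) *
        (fun r : ℝ × ℝ => Complex.exp ((b * r.1 : ℝ) * Complex.I) *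
          Complex.exp ((c * r.2 : ℝ) * Complex.I)) p.2 := by
    intro p
    simp only
    rw [← Complex.exp_add, ← Complex.exp_add]
    congr 1
    push_cast
    ring
  rw [integral_congr_ae (Filter.Eventually.of_forall e)]
  refine (integral_prod_mul (μ := gam) (ν := gam.prod gam)
    (fun x : ℝ => Complex.exp ((a * x : ℝ) * Complex.I)) (fun r : ℝ × ℝ =>
      Complex.exp ((b * r.1 : ℝ) * Complex.I) * Complex.exp ((c * r.2 : ℝ) * Complex.I))).trans ?_
  rw [integral_prod_mul (μ := gam) (ν := gam) (fun x : ℝ => Complex.exp ((b * x : ℝ) * Complex.I))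
      (fun x : ℝ => Complex.exp ((c * x : ℝ) * Complex.I)),
    gam_char, gam_char, gam_char, ← Complex.exp_add, ← Complex.exp_add]
  congr 1
  push_cast
  ring

lemma gam3_law {a b c a' b' c' d e f d' e' f' : ℝ}
    (h1 : a ^ 2 + b ^ 2 + c ^ 2 = d ^ 2 + e ^ 2 + f ^ 2)
    (h2 : a' ^ 2 + b' ^ 2 + c' ^ 2 = d' ^ 2 + e' ^ 2 + f' ^ 2)
    (h3 : a * a' + b * b' + c * c' = d * d' + e * e' + f * f')
    {F : ℝ → ℝ → ℝ} (hF : Measurable (Function.uncurry F)) :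
    ∫ p, F (a * p.1 + b * p.2.1 + c * p.2.2) (a' * p.1 + b' * p.2.1 + c' * p.2.2) ∂gam3
    = ∫ p, F (d * p.1 + e * p.2.1 + f * p.2.2) (d' * p.1 + e' * p.2.1 + f' * p.2.2) ∂gam3 := by
  let S : ℝ × ℝ × ℝ → ℝ × ℝ := fun p =>
    (a * p.1 + b * p.2.1 + c * p.2.2, a' * p.1 + b' * p.2.1 + c' * p.2.2)
  let T : ℝ × ℝ × ℝ → ℝ × ℝ := fun p =>
    (d * p.1 + e * p.2.1 + f * p.2.2, d' * p.1 + e' * p.2.1 + f' * p.2.2)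
  have hS : Measurable S := by fun_prop
  have hT : Measurable T := by fun_prop
  have key : gam3.map S = gam3.map T := by
    have := Measure.isProbabilityMeasure_map (μ := gam3) hS.aemeasurable
    have := Measure.isProbabilityMeasure_map (μ := gam3) hT.aemeasurable
    apply Measure.ext_of_charFunDual
    funext L
    have hL : ∀ v : ℝ × ℝ, L v = v.1 * L (1, 0) + v.2 * L (0, 1) := by
      intro v
      have : v = v.1 • ((1 : ℝ), (0 : ℝ)) + v.2 • ((0 : ℝ), (1 : ℝ)) := by ext <;> simp
      conv_lhs => rw [this]
      rw [map_add, map_smul, map_smul]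
      simp
    rw [charFunDual_apply, charFunDual_apply,
      integral_map hS.aemeasurable (by fun_prop),
      integral_map hT.aemeasurable (by fun_prop)]
    set l := L (1, 0)
    set m := L (0, 1)
    have e1 : ∀ p, L (S p) = (l * a + m * a') * p.1 + (l * b + m * b') * p.2.1
        + (l * c + m * c') * p.2.2 := by
      intro p; rw [hL]; simp only [S]; ring
    have e2 : ∀ p, L (T p) = (l * d + m * d') * p.1 + (l * e + m * e') * p.2.1
        + (l * f + m * f') * p.2.2 := by
      intro p; rw [hL]; simp only [T]; ring
    simp_rw [e1, e2]
    rw [gam3_char, gam3_char]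
    congr 3
    linear_combination (-l ^ 2) * h1 - m ^ 2 * h2 - 2 * l * m * h3
  have h := congrArg (fun M => ∫ v, Function.uncurry F v ∂M) key
  beta_reduce at h
  rw [integral_map hS.aemeasurable hF.aestronglyMeasurable,
      integral_map hT.aemeasurable hF.aestronglyMeasurable] at h
  exact h

lemma gam_pos (c s : ℝ) (p : ℝ → ℝ) (hp : ∀ x, 0 ≤ p x) (he : ∀ x, p (-x) = p x)
    (hm : Measurable p) :
    0 ≤ c * ∫ z, (c + s * z) * p (c + s * z) ∂gam := by
  by_cases hs : s = 0
  · simp only [hs, zero_mul, add_zero, integral_const, smul_eq_mul]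
    simp only [probReal_univ, one_mul]
    nlinarith [mul_nonneg (mul_self_nonneg c) (hp c)]
  set v : NNReal := ⟨s ^ 2, sq_nonneg s⟩ with hv
  have hv0 : v ≠ 0 := by
    intro h
    have : (v : ℝ) = 0 := by rw [h]; rfl
    exact hs (pow_eq_zero_iff two_ne_zero |>.mp this)
  have hmap : gam.map (fun z => c + s * z) = gaussianReal c v := by
    have := gaussianReal_map_const_mul (μ := 0) (v := 1) s
    have h2 := gaussianReal_map_const_add (μ := s * 0) (v := v) c
    rw [mul_one] at this
    change _ = gaussianReal (s * 0) v at this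
    rw [← this, Measure.map_map (by fun_prop) (by fun_prop)] at h2
    simpa [Function.comp_def] using h2
  have e : ∫ z, (c + s * z) * p (c + s * z) ∂gam = ∫ y, y * p y ∂(gaussianReal c v) := by
    rw [← hmap, integral_map (by fun_prop) (by fun_prop)]
  rw [e, integral_gaussianReal_eq_integral_smul hv0]
  set J := ∫ x, gaussianPDFReal c v x • (x * p x) with hJ
  by_cases hi : Integrable (fun x => gaussianPDFReal c v x • (x * p x))
  swap
  · rw [hJ, integral_undef hi]; simp
  have hJ2 : J = ∫ x, gaussianPDFReal c v (-x) • ((-x) * p (-x)) :=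
    (integral_neg_eq_self (fun x => gaussianPDFReal c v x • (x * p x)) volume).symm
  have hi2 := hi.comp_neg
  have : c * (J + J) = ∫ x, c * (gaussianPDFReal c v x • (x * p x)
      + gaussianPDFReal c v (-x) • ((-x) * p (-x))) := by
    rw [integral_const_mul, integral_add hi hi2, ← hJ2]
  have h0 : 0 ≤ c * (J + J) := by
    rw [this]
    apply integral_nonneg
    intro x
    simp only [smul_eq_mul, he, gaussianPDFReal_def, Pi.zero_apply]
    have hk : (0:ℝ) ≤ (√(2 * Real.pi * v))⁻¹ := by positivity
    have hd : 0 ≤ (c * x) * (Real.exp (-(x - c) ^ 2 / (2 * v)) -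
        Real.exp (-(-x - c) ^ 2 / (2 * v))) := by
      have hvp : (0:ℝ) < 2 * v := by positivity
      rcases le_total 0 (c * x) with h | h
      · apply mul_nonneg h
        rw [sub_nonneg, Real.exp_le_exp]
        apply (div_le_div_iff_of_pos_right hvp).2
        nlinarith
      · apply mul_nonneg_of_nonpos_of_nonpos h
        rw [sub_nonpos, Real.exp_le_exp]
        apply (div_le_div_iff_of_pos_right hvp).2
        nlinarith
    have := mul_nonneg (mul_nonneg hk (hp x)) hd
    nlinarith [this]
  linarith

lemma hasDerivAt_tanh_aux (x : ℝ) : HasDerivAt Real.tanh (1 / Real.cosh x ^ 2) x := by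
  have h := (Real.hasDerivAt_sinh x).div (Real.hasDerivAt_cosh x) (Real.cosh_pos x).ne'
  have e : Real.tanh = fun y => Real.sinh y / Real.cosh y := by
    funext y; exact Real.tanh_eq_sinh_div_cosh y
  rw [e]
  convert! h using 1
  have := Real.cosh_sq x
  congr 1
  linear_combination (-1 : ℝ) * this

lemma tanh_lip (x y : ℝ) : |Real.tanh x - Real.tanh y| ≤ |x - y| := by
  have := Convex.norm_image_sub_le_of_norm_hasDerivWithin_le (f := Real.tanh)
    (f' := fun x => 1 / Real.cosh x ^ 2) (C := 1) (s := Set.univ) (x := y) (y := x)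
    (fun z _ => (hasDerivAt_tanh_aux z).hasDerivWithinAt) (fun z _ => by
      have := Real.one_le_cosh z
      rw [Real.norm_of_nonneg (by positivity), div_le_one (by positivity)]
      nlinarith) convex_univ trivial trivial
  simpa using this

lemma tanh_strictMono_aux : StrictMono Real.tanh :=
  strictMono_of_hasDerivAt_pos hasDerivAt_tanh_aux (fun x => by
    have := Real.cosh_pos x
    positivity)

lemma tanh_meas : Measurable Real.tanh :=
  (continuous_iff_continuousAt.2 fun x => (hasDerivAt_tanh_aux x).continuousAt).measurable

lemma gam3_int12 (f : ℝ → ℝ → ℝ) (hi : Integrable (fun p : ℝ × ℝ × ℝ => f p.1 p.2.1) gam3) :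
    ∫ p, f p.1 p.2.1 ∂gam3 = ∫ x, ∫ y, f x y ∂gam ∂gam := by
  rw [integral_prod _ hi]
  congr 1
  funext x
  have := integral_fun_fst (μ := gam) (ν := gam) (f x)
  simpa using this

lemma gam3_int1 (f : ℝ → ℝ) : ∫ p, f p.1 ∂gam3 = ∫ x, f x ∂gam := by
  have := integral_fun_fst (μ := gam) (ν := gam.prod gam) f
  simpa using this

lemma gam_neg (f : ℝ → ℝ) (hf : Measurable f) : ∫ x, f (-x) ∂gam = ∫ x, f x ∂gam := by
  have h := gaussianReal_map_neg (μ := 0) (v := 1)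
  rw [neg_zero] at h
  conv_rhs => rw [gam, ← h]
  rw [integral_map (by fun_prop) (by fun_prop)]

lemma odd_contr (r s C : ℝ) (hr : 0 < r) (hrs : r ^ 2 + s ^ 2 = 1) (o : ℝ → ℝ)
    (hm : Measurable o) (ho : ∀ x, o (-x) = - o x) (hC : ∀ x, |o x| ≤ C * |x|) :
    ∫ p, o p.1 * o (r * p.1 + s * p.2.1) ∂gam3 ≤ r * ∫ x, o x ^ 2 ∂gam := by
  have hC0 : 0 ≤ C := by
    have := (abs_nonneg _).trans (hC 1)
    simpa using this
  obtain ⟨k, hk⟩ : ∃ k : ℝ → ℝ, k = fun x => o x / x := ⟨_, rfl⟩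
  have hkm : Measurable k := by rw [hk]; fun_prop
  have hko : ∀ x, o x = x * k x := by
    intro x
    by_cases hx : x = 0
    · have := ho 0
      simp only [neg_zero] at this
      rw [hx, zero_mul]; linarith
    · rw [hk]; field_simp
  have hke : ∀ x, k (-x) = k x := by
    intro x; simp only [hk, ho, neg_div_neg_eq]
  have hkC : ∀ x, |k x| ≤ C := by
    intro x
    by_cases hx : x = 0
    · simp [hk, hx, hC0]
    · simp only [hk]
      rw [abs_div, div_le_iff₀ (abs_pos.2 hx)]
      exact hC x
  have i2 : Integrable (fun x : ℝ => x ^ 2) gam :=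
    (memLp_id_gaussianReal' 2 (by simp)).integrable_sq
  have i1 : Integrable (fun x : ℝ => x) gam :=
    (memLp_id_gaussianReal' 1 (by simp)).integrable le_rfl
  have ixy : Integrable (fun p : ℝ × ℝ × ℝ => p.1 * (r * p.1 + s * p.2.1)) gam3 := by
    have h1 : Integrable (fun p : ℝ × ℝ × ℝ => p.1 ^ 2) gam3 := i2.comp_fst _
    have h2 : Integrable (fun p : ℝ × ℝ × ℝ => p.1 * p.2.1) gam3 :=
      Integrable.mul_prod (g := fun q : ℝ × ℝ => q.1) i1 (i1.comp_fst _)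
    have := (h1.const_mul r).add (h2.const_mul s)
    refine this.congr (Filter.Eventually.of_forall fun p => ?_)
    simp only [Pi.add_apply]
    ring
  have ib : ∀ (g : ℝ × ℝ × ℝ → ℝ) (D : ℝ), Measurable g → (∀ p, |g p| ≤ D) →
      Integrable (fun p : ℝ × ℝ × ℝ => p.1 * (r * p.1 + s * p.2.1) * g p) gam3 := by
    intro g D hg hD
    exact ixy.mul_bdd hg.aestronglyMeasurable (Filter.Eventually.of_forall hD)
  have hkk : ∀ x y, |k x * k y| ≤ C * C := by
    intro x y
    rw [abs_mul]
    exact mul_le_mul (hkC x) (hkC y) (abs_nonneg _) hC0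
  have I1 := ib (fun p => k p.1 * k p.1) (C * C) (by fun_prop) (fun p => hkk _ _)
  have I2 := ib (fun p => k (r * p.1 + s * p.2.1) * k (r * p.1 + s * p.2.1)) (C * C)
    (by fun_prop) (fun p => hkk _ _)
  have I3 := ib (fun p => k p.1 * k (r * p.1 + s * p.2.1)) (C * C)
    (by fun_prop) (fun p => hkk _ _)
  have I12 := (I1.add I2).sub (I3.const_mul 2)
  have I4 : Integrable (fun p : ℝ × ℝ × ℝ => (fun x y => x * (r * x + s * y) *
      (k x - k (r * x + s * y)) ^ 2) p.1 p.2.1) gam3 := by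
    refine I12.congr (Filter.Eventually.of_forall fun p => ?_)
    simp only [Pi.add_apply, Pi.sub_apply]
    ring
  have pos : 0 ≤ ∫ p : ℝ × ℝ × ℝ, (fun x y => x * (r * x + s * y) *
      (k x - k (r * x + s * y)) ^ 2) p.1 p.2.1 ∂gam3 := by
    rw [gam3_int12 (fun x y => x * (r * x + s * y) * (k x - k (r * x + s * y)) ^ 2) I4]
    apply integral_nonneg
    intro x
    have := gam_pos (r * x) s (fun y => (k x - k y) ^ 2) (fun y => sq_nonneg _)
      (fun y => by simp only [hke]) (by fun_prop)
    simp only [Pi.zero_apply]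
    simp_rw [mul_assoc x]
    rw [integral_const_mul]
    rw [mul_assoc] at this
    exact nonneg_of_mul_nonneg_right this hr
  have e4 : ∫ p : ℝ × ℝ × ℝ, (fun x y => x * (r * x + s * y) *
      (k x - k (r * x + s * y)) ^ 2) p.1 p.2.1 ∂gam3
      = ∫ p : ℝ × ℝ × ℝ, p.1 * (r * p.1 + s * p.2.1) * (k p.1 * k p.1) ∂gam3
      + ∫ p : ℝ × ℝ × ℝ, p.1 * (r * p.1 + s * p.2.1) *
        (k (r * p.1 + s * p.2.1) * k (r * p.1 + s * p.2.1)) ∂gam3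
      - 2 * ∫ p : ℝ × ℝ × ℝ, p.1 * (r * p.1 + s * p.2.1) *
        (k p.1 * k (r * p.1 + s * p.2.1)) ∂gam3 := by
    rw [← integral_const_mul, ← integral_add I1 I2]
    refine Eq.trans ?_ (integral_sub (I1.add I2) (I3.const_mul 2))
    congr 1
    funext p
    simp only [Pi.add_apply]
    ring
  have e2 : ∫ p : ℝ × ℝ × ℝ, p.1 * (r * p.1 + s * p.2.1) *
        (k (r * p.1 + s * p.2.1) * k (r * p.1 + s * p.2.1)) ∂gam3
      = ∫ p : ℝ × ℝ × ℝ, p.1 * (r * p.1 + s * p.2.1) * (k p.1 * k p.1) ∂gam3 := by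
    have := gam3_law (a := 1) (b := 0) (c := 0) (a' := r) (b' := s) (c' := 0)
      (d := r) (e := s) (f := 0) (d' := 1) (e' := 0) (f' := 0) (by linarith) (by linarith)
      (by ring) (F := fun x y => x * y * (k y * k y))
      (by simp only [Function.uncurry_def]; fun_prop)
    simp only [one_mul, zero_mul, add_zero] at this
    rw [this]
    congr 1
    funext p
    ring
  have e1 : ∫ p : ℝ × ℝ × ℝ, p.1 * (r * p.1 + s * p.2.1) * (k p.1 * k p.1) ∂gam3
      = r * ∫ x, o x ^ 2 ∂gam := by
    rw [gam3_int12 (fun x y => x * (r * x + s * y) * (k x * k x)) I1, ← integral_const_mul]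
    congr 1
    funext x
    have : ∀ y, x * (r * x + s * y) * (k x * k x) = r * o x ^ 2 + (x * s * (k x * k x)) * y := by
      intro y; rw [hko]; ring
    simp_rw [this]
    rw [integral_add (integrable_const _) (i1.const_mul _), integral_const_mul,
      integral_const_mul, integral_id_gaussianReal]
    simp
  have e3 : ∫ p : ℝ × ℝ × ℝ, p.1 * (r * p.1 + s * p.2.1) *
        (k p.1 * k (r * p.1 + s * p.2.1)) ∂gam3
      = ∫ p, o p.1 * o (r * p.1 + s * p.2.1) ∂gam3 := by
    congr 1
    funext p
    rw [hko p.1, hko (r * p.1 + s * p.2.1)]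
    ring
  rw [e4, e2, e1, e3] at pos
  linarith

lemma even_pos (r s : ℝ) (hr : 0 < r) (hrs : r ^ 2 + s ^ 2 = 1) (e : ℝ → ℝ)
    (hm : Measurable e) (hb : ∀ x, |e x| ≤ 1) :
    (∫ x, e x ∂gam) ^ 2 ≤ ∫ p, e p.1 * e (r * p.1 + s * p.2.1) ∂gam3 := by
  have hr1 : r ≤ 1 := by nlinarith [sq_nonneg s]
  set a := √r with ha
  set b := √(1 - r) with hb'
  have ha2 : a ^ 2 = r := Real.sq_sqrt hr.le
  have hb2 : b ^ 2 = 1 - r := Real.sq_sqrt (by linarith)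
  have L := gam3_law (a := 1) (b := 0) (c := 0) (a' := r) (b' := s) (c' := 0)
      (d := a) (e := b) (f := 0) (d' := a) (e' := 0) (f' := b) (by linarith) (by linarith)
      (by linarith) (F := fun x y => e x * e y)
      (by simp only [Function.uncurry_def]; fun_prop)
  simp only [one_mul, zero_mul, add_zero] at L
  have L1 := gam3_law (a := 1) (b := 0) (c := 0) (a' := 0) (b' := 0) (c' := 0)
      (d := a) (e := b) (f := 0) (d' := 0) (e' := 0) (f' := 0) (by linarith) (by linarith)
      (by ring) (F := fun x y => e x)
      (by simp only [Function.uncurry_def]; fun_prop)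
  simp only [one_mul, zero_mul, add_zero] at L1
  rw [gam3_int1] at L1
  have ib : ∀ {M : Type} [MeasurableSpace M] (μ : Measure M) [IsProbabilityMeasure μ] (g : M → ℝ),
      Measurable g → Integrable (fun p => e (g p)) μ := by
    intro M _ μ _ g hg
    exact Integrable.of_bound (hm.comp hg).aestronglyMeasurable 1
      (Filter.Eventually.of_forall fun x => hb _)
  rw [gam3_int12 (fun x y => e (a * x + b * y)) (ib _ _ (by fun_prop))] at L1
  obtain ⟨G, hG⟩ : ∃ G : ℝ → ℝ, G = fun x => ∫ y, e (a * x + b * y) ∂gam := ⟨_, rfl⟩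
  have hGm : StronglyMeasurable G := by
    rw [hG]
    exact StronglyMeasurable.integral_prod_right (f := fun x y => e (a * x + b * y))
      (by simp only [Function.uncurry_def]; exact Measurable.stronglyMeasurable (by fun_prop))
  have hGb : ∀ x, ‖G x‖ ≤ 1 := by
    intro x
    rw [hG]
    have := norm_integral_le_of_norm_le_const (μ := gam) (f := fun y => e (a * x + b * y))
      (C := 1) (Filter.Eventually.of_forall fun y => hb _)
    simpa using this
  have iG : Integrable G gam := Integrable.of_bound hGm.aestronglyMeasurable 1
    (Filter.Eventually.of_forall hGb)
  have iG2 : Integrable (fun x => G x ^ 2) gam :=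
    Integrable.of_bound (hGm.pow 2).aestronglyMeasurable 1 (Filter.Eventually.of_forall fun x => by
      rw [norm_pow]; exact pow_le_one₀ (norm_nonneg _) (hGb x))
  have hL : ∫ p, e (a * p.1 + b * p.2.1) * e (a * p.1 + b * p.2.2) ∂gam3 = ∫ x, G x ^ 2 ∂gam := by
    have ii : Integrable (fun p : ℝ × ℝ × ℝ => e (a * p.1 + b * p.2.1) * e (a * p.1 + b * p.2.2))
        gam3 := (ib gam3 (fun p => a * p.1 + b * p.2.1) (by fun_prop)).mul_bdd (c := 1)
          (Measurable.aestronglyMeasurable (by fun_prop))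
          (Filter.Eventually.of_forall fun x => hb _)
    rw [integral_prod _ ii]
    congr 1
    funext x
    rw [hG, sq]
    exact integral_prod_mul (fun y => e (a * x + b * y)) (fun y => e (a * x + b * y))
  rw [L, hL, L1]
  change (∫ x, (fun x => ∫ y, e (a * x + b * y) ∂gam) x ∂gam) ^ 2 ≤ _
  rw [← hG]
  set m := ∫ x, G x ∂gam with hmdef
  have h0 : 0 ≤ ∫ x, (G x - m) ^ 2 ∂gam := integral_nonneg fun x => sq_nonneg _
  have h1 : ∫ x, (G x - m) ^ 2 ∂gam = ∫ x, G x ^ 2 ∂gam - m ^ 2 := by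
    have : ∀ x, (G x - m) ^ 2 = G x ^ 2 - (2 * m * G x - m ^ 2) := by intro x; ring
    simp_rw [this]
    have iL : Integrable (fun x => 2 * m * G x - m ^ 2) gam :=
      (iG.const_mul _).sub (integrable_const _)
    rw [integral_sub iG2 iL,
      integral_sub (iG.const_mul _) (integrable_const _), integral_const_mul, ← hmdef]
    simp
    ring
  linarith

lemma main_aux (r s C : ℝ) (hr : 0 < r) (hrs : r ^ 2 + s ^ 2 = 1) (F : ℝ → ℝ)
    (hm : Measurable F) (hb : ∀ x, |F x| ≤ 1) (hC : ∀ x, |F x - F (-x)| ≤ C * |x|) :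
    (∫ x, F x ∂gam) ^ 2 - r * ∫ x, F x ^ 2 ∂gam ≤
      ∫ x, ∫ y, F x * F (-r * x + s * y) ∂gam ∂gam := by
  obtain ⟨e, he⟩ : ∃ e : ℝ → ℝ, e = fun x => (F x + F (-x)) / 2 := ⟨_, rfl⟩
  obtain ⟨o, ho⟩ : ∃ o : ℝ → ℝ, o = fun x => (F x - F (-x)) / 2 := ⟨_, rfl⟩
  have hem : Measurable e := by rw [he]; fun_prop
  have hom : Measurable o := by rw [ho]; fun_prop
  have hFe : ∀ x, F x = e x + o x := by intro x; rw [he, ho]; ring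
  have hee : ∀ x, e (-x) = e x := by intro x; simp only [he, neg_neg]; ring
  have hoo : ∀ x, o (-x) = - o x := by intro x; simp only [ho, neg_neg]; ring
  have heb : ∀ x, |e x| ≤ 1 := by
    intro x
    have h1 := abs_le.1 (hb x); have h2 := abs_le.1 (hb (-x))
    simp only [he]
    rw [abs_le]; constructor <;> linarith
  have hob : ∀ x, |o x| ≤ 1 := by
    intro x
    have h1 := abs_le.1 (hb x); have h2 := abs_le.1 (hb (-x))
    simp only [ho]
    rw [abs_le]; constructor <;> linarith
  have hoC : ∀ x, |o x| ≤ C / 2 * |x| := by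
    intro x
    simp only [ho]
    rw [abs_div, abs_two]
    linarith [hC x]
  have E := even_pos r s hr hrs e hem heb
  have O := odd_contr r s (C / 2) hr hrs o hom hoo hoC
  have ib : ∀ {M : Type} [MeasurableSpace M] (μ : Measure M) [IsProbabilityMeasure μ]
      (u v : ℝ → ℝ) (f g : M → ℝ), Measurable u → Measurable v → (∀ x, |u x| ≤ 1) →
      (∀ x, |v x| ≤ 1) → Measurable f → Measurable g →
      Integrable (fun p => u (f p) * v (g p)) μ := by
    intro M _ μ _ u v f g hu hv hu1 hv1 hf hg
    refine Integrable.of_bound (by fun_prop) 1 (Filter.Eventually.of_forall fun x => ?_)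
    rw [norm_mul]
    exact mul_le_one₀ (hu1 _) (norm_nonneg _) (hv1 _)
  have hem1 : ∫ x, e x ∂gam = ∫ x, F x ∂gam := by
    have iF : Integrable F gam :=
      Integrable.of_bound (by fun_prop) 1 (Filter.Eventually.of_forall hb)
    have iF' : Integrable (fun x => F (-x)) gam :=
      Integrable.of_bound (Measurable.aestronglyMeasurable (by fun_prop)) 1 (Filter.Eventually.of_forall fun x => hb _)
    rw [he, integral_div, integral_add iF iF', gam_neg F hm]
    ring
  have ho2 : ∫ x, o x ^ 2 ∂gam ≤ ∫ x, F x ^ 2 ∂gam := by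
    have h1 := gam_neg (fun x => F x ^ 2) (by fun_prop)
    have i1 := ib gam F F (fun x => x) (fun x => x) hm hm hb hb (by fun_prop) (by fun_prop)
    have i2 := ib gam F F (fun x => -x) (fun x => -x) hm hm hb hb (by fun_prop) (by fun_prop)
    have i3 := ib gam o o (fun x => x) (fun x => x) hom hom hob hob (by fun_prop) (by fun_prop)
    simp only [← sq] at i1 i2 i3
    have h2 : ∫ x, (F x ^ 2 + F (-x) ^ 2) / 2 ∂gam = ∫ x, F x ^ 2 ∂gam := by
      rw [integral_div, integral_add i1 i2, h1]; ring
    rw [← h2]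
    apply integral_mono i3 ((i1.add i2).div_const 2)
    intro x
    simp only [ho, Pi.add_apply]
    nlinarith [sq_nonneg (F x + F (-x))]
  have A := gam3_law (a := 1) (b := 0) (c := 0) (a' := -r) (b' := s) (c' := 0)
      (d := 1) (e := 0) (f := 0) (d' := -r) (e' := -s) (f' := 0) (by ring) (by ring)
      (by ring) (F := fun x y => F x * F y)
      (by simp only [Function.uncurry_def]; fun_prop)
  have B := gam3_law (a := 1) (b := 0) (c := 0) (a' := -r) (b' := s) (c' := 0)
      (d := -1) (e := 0) (f := 0) (d' := r) (e' := s) (f' := 0) (by ring) (by ring)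
      (by ring) (F := fun x y => F x * F y)
      (by simp only [Function.uncurry_def]; fun_prop)
  simp only [one_mul, zero_mul, add_zero] at A B
  rw [← gam3_int12 (fun x y => F x * F (-r * x + s * y))
    (ib gam3 F F (fun p => p.1) (fun p => -r * p.1 + s * p.2.1) hm hm hb hb
      (by fun_prop) (by fun_prop))]
  set P := ∫ p : ℝ × ℝ × ℝ, F p.1 * F (-r * p.1 + s * p.2.1) ∂gam3 with hP
  have key : P + P = 2 * (∫ p, e p.1 * e (r * p.1 + s * p.2.1) ∂gam3) -
      2 * ∫ p, o p.1 * o (r * p.1 + s * p.2.1) ∂gam3 := by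
    conv_lhs => lhs; rw [A]
    conv_lhs => rhs; rw [B]
    have j1 := ib gam3 F F (fun p => p.1) (fun p => -r * p.1 + -s * p.2.1) hm hm hb hb
      (by fun_prop) (by fun_prop)
    have j2 := ib gam3 F F (fun p => -1 * p.1) (fun p => r * p.1 + s * p.2.1) hm hm hb hb
      (by fun_prop) (by fun_prop)
    have j3 := ib gam3 e e (fun p => p.1) (fun p => r * p.1 + s * p.2.1) hem hem heb heb
      (by fun_prop) (by fun_prop)
    have j4 := ib gam3 o o (fun p => p.1) (fun p => r * p.1 + s * p.2.1) hom hom hob hob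
      (by fun_prop) (by fun_prop)
    rw [← integral_add j1 j2, ← integral_const_mul, ← integral_const_mul,
      ← integral_sub (j3.const_mul 2) (j4.const_mul 2)]
    congr 1
    funext p
    have n1 : -r * p.1 + -s * p.2.1 = -(r * p.1 + s * p.2.1) := by ring
    have n2 : -1 * p.1 = -p.1 := by ring
    rw [n1, n2, hFe p.1, hFe (-(r * p.1 + s * p.2.1)), hFe (-p.1), hFe (r * p.1 + s * p.2.1),
      hee, hee, hoo, hoo]
    ring
  rw [hem1] at E
  have := mul_le_mul_of_nonneg_left ho2 hr.le
  linarith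

lemma chi_ne (h c : ℝ) (hh : h ≠ 0) : ∫ z, Real.tanh (h + c * z) ∂gam ≠ 0 := by
  have key : ∀ h : ℝ, 0 < h → 0 < ∫ z, Real.tanh (h + c * z) ∂gam := by
    intro h hh
    have hm : Measurable (fun z => Real.tanh (h + c * z)) := tanh_meas.comp (by fun_prop)
    have hm' : Measurable (fun z => Real.tanh (h + c * -z)) := tanh_meas.comp (by fun_prop)
    have i1 : Integrable (fun z => Real.tanh (h + c * z)) gam :=
      Integrable.of_bound hm.aestronglyMeasurable 1
        (Filter.Eventually.of_forall fun x => (Real.abs_tanh_lt_one _).le)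
    have i2 : Integrable (fun z => Real.tanh (h + c * -z)) gam :=
      Integrable.of_bound hm'.aestronglyMeasurable 1
        (Filter.Eventually.of_forall fun x => (Real.abs_tanh_lt_one _).le)
    have e := gam_neg _ hm
    have p : ∀ z, 0 < Real.tanh (h + c * z) + Real.tanh (h + c * -z) := by
      intro z
      have h1 : Real.tanh (-(h + c * z)) < Real.tanh (h + c * -z) :=
        tanh_strictMono_aux (by linarith)
      rw [Real.tanh_neg] at h1
      linarith
    have : 0 < ∫ z, (Real.tanh (h + c * z) + Real.tanh (h + c * -z)) ∂gam := by
      rw [integral_pos_iff_support_of_nonneg (fun z => (p z).le) (i1.add i2)]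
      have : Function.support (fun z => Real.tanh (h + c * z) + Real.tanh (h + c * -z))
          = Set.univ := by
        ext z
        simp only [Function.mem_support, Set.mem_univ, iff_true]
        exact (p z).ne'
      rw [this]; simp
    rw [integral_add i1 i2, e] at this
    linarith
  rcases lt_or_gt_of_ne hh with h1 | h1
  · have h2 := key (-h) (by linarith)
    have hm : Measurable (fun z => Real.tanh (-h + c * z)) := tanh_meas.comp (by fun_prop)
    rw [← gam_neg _ hm] at h2
    have : ∀ z, Real.tanh (-h + c * -z) = - Real.tanh (h + c * z) := by
      intro z; rw [← Real.tanh_neg]; congr 1; ring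
    simp_rw [this] at h2
    rw [integral_neg] at h2
    intro h3
    rw [h3] at h2
    simp at h2
  · exact ne_of_gt (key h h1)

/-- Let `q ≥ 0` be the replica-symmetric fixed point `q = φ(q)` and `φ̄(t) = ψ(t,q,q)`.
Then `φ̄(t) ≥ χ(q)² + t` for `t ∈ [−q, 0)`; in particular for `h ≠ 0`, `φ̄` has no fixed
point in `[−q, 0]`. -/
theorem stmt13 (h β q : ℝ) (hq : 0 ≤ q) (hfix : phi h β q = q) :
    (∀ t, -q ≤ t → t < 0 → chi h β q ^ 2 + t ≤ psi h β t q q) ∧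
    (h ≠ 0 → ∀ t, -q ≤ t → t ≤ 0 → psi h β t q q ≠ t) := by
  have main : ∀ t, -q ≤ t → t < 0 → chi h β q ^ 2 + t ≤ psi h β t q q := by
    intro t ht1 ht2
    have hq0 : 0 < q := by linarith
    have hsq : √q ^ 2 = q := Real.sq_sqrt hq
    have hsp : 0 < √q := Real.sqrt_pos.2 hq0
    obtain ⟨r, hr⟩ : ∃ r, r = -t / q := ⟨_, rfl⟩
    have hr0 : 0 < r := by rw [hr]; apply div_pos <;> linarith
    have hr1 : r ≤ 1 := by rw [hr, div_le_one hq0]; linarith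
    have htr : t = -r * q := by rw [hr]; field_simp
    have M := main_aux r (√(1 - r ^ 2)) (2 * |β * √q|) hr0
      (by rw [Real.sq_sqrt (by nlinarith)]; ring) (fun x => Real.tanh (h + β * √q * x))
      (tanh_meas.comp (by fun_prop)) (fun x => (Real.abs_tanh_lt_one _).le) (by
        intro x
        refine (tanh_lip _ _).trans (le_of_eq ?_)
        rw [mul_assoc 2, ← abs_mul]
        rw [← abs_two (α := ℝ)]
        rw [← abs_mul]
        congr 1
        ring)
    have e1 : t / √q = -r * √q := by
      rw [div_eq_iff hsp.ne', htr]
      linear_combination r * hsq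
    have e2 : √(q - t ^ 2 / q) = √q * √(1 - r ^ 2) := by
      rw [← Real.sqrt_mul hq]
      congr 1
      rw [htr]; field_simp
    have e3 : psi h β t q q = ∫ x, ∫ y, Real.tanh (h + β * √q * x) *
        Real.tanh (h + β * √q * (-r * x + √(1 - r ^ 2) * y)) ∂gam ∂gam := by
      unfold psi
      rw [e1, e2]
      congr 1; funext x; congr 1; funext y
      congr 2 <;> ring
    have e4 : ∫ x, Real.tanh (h + β * √q * x) ^ 2 ∂gam = q := hfix
    rw [e3]
    rw [e4] at M
    refine le_trans (le_of_eq ?_) M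
    rw [htr, chi]
    ring
  refine ⟨main, fun hh t ht1 ht2 => ?_⟩
  have hc : 0 < chi h β q ^ 2 := by
    have := chi_ne h (β * √q) hh
    exact sq_pos_of_ne_zero this
  rcases ht2.lt_or_eq with h1 | h1
  · have := main t ht1 h1
    intro h2
    linarith
  · have : psi h β t q q = chi h β q ^ 2 := by
      unfold psi chi
      rw [h1]
      simp only [zero_div, zero_mul, zero_add, ne_eq, OfNat.ofNat_ne_zero, not_false_eq_true,
        zero_pow, sub_zero, ← mul_assoc]
      simp_rw [integral_const_mul, integral_mul_const]
      ring
    rw [this, h1]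
    exact hc.ne'
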